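/- Let Z be a Brown–Resnick stationary random field with values in E satisfying E[Z(t)] = 1 for all t ∈ ℤ^d and max_{t∈ℤ^d} Z(t) > 0 almost surely, and let Θ be its spectral tail field. Then the classical extremal index H_Z = lim_{n→∞} n^{−d} E[max_{t∈{0,…,n}^d} Z(t)] equals 1 if and only if P(Θ(i) = 0) = 1 for every i ∈ ℤ^d with i ≠ 0, equivalently if and only if Z(0)·Z(i) = 0 almost surely for every i ≠ 0. -/

import Mathlib

open MeasureTheory ENNReal Filter
open scoped NNReal ENNReal

/-- Index set `ℤ^d`. -/
abbrev Idx (d : ℕ) := Fin d → ℤ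

/-- The space `E = [0,∞)^{ℤ^d}` (with the product σ-field). -/
abbrev Fld (d : ℕ) := Idx d → ℝ≥0

/-- The shift `B^h`, acting by `(B^h f)(t) = f (t - h)`. -/
def shift {d : ℕ} (h : Idx d) (f : Fld d) : Fld d := fun t => f (t - h)

/-- `F : E → [0,∞]` is 0-homogeneous if `F (c • f) = F f` for all `c > 0`. -/
def Homog0 {d : ℕ} (F : Fld d → ℝ≥0∞) : Prop :=
  ∀ c : ℝ≥0, 0 < c → ∀ f : Fld d, F (fun t => c * f t) = F f

/-- `Z` is a Brown–Resnick stationary random field with unit means: it is measurable,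
`E[Z(t)] = 1` for all `t`, and `E[Z(h) F(Z)] = E[Z(0) F(B^h Z)]` for every measurable
0-homogeneous `F : E → [0,∞]`. -/
structure IsBRS {d : ℕ} {Ω : Type*} [MeasurableSpace Ω] (P : Measure Ω)
    (Z : Ω → Fld d) : Prop where
  meas : Measurable Z
  mean_one : ∀ t : Idx d, ∫⁻ ω, (Z ω t : ℝ≥0∞) ∂P = 1
  tilt_shift : ∀ (h : Idx d) (F : Fld d → ℝ≥0∞), Measurable F → Homog0 F →
    ∫⁻ ω, (Z ω h : ℝ≥0∞) * F (Z ω) ∂P = ∫⁻ ω, (Z ω 0 : ℝ≥0∞) * F (shift h (Z ω)) ∂P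

/-- The discrete cube `{0,1,…,n}^d ⊆ ℤ^d`. -/
def cube (d n : ℕ) : Set (Idx d) := {t | ∀ j, 0 ≤ t j ∧ t j ≤ (n : ℤ)}

/-- `E[max_{t ∈ {0,…,n}^d} Z(t)]`. -/
noncomputable def cubeMaxExp {d : ℕ} {Ω : Type*} [MeasurableSpace Ω] (P : Measure Ω)
    (Z : Ω → Fld d) (n : ℕ) : ℝ≥0∞ :=
  ∫⁻ ω, ⨆ t ∈ cube d n, (Z ω t : ℝ≥0∞) ∂P

/-- The spectral tail field: `Θ` (on a possibly different probability space `Q`) has law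
`P(Θ ∈ A) = E[Z(0)·1{Z/Z(0) ∈ A}]` (the integrand vanishing on `{Z(0) = 0}`). -/
def IsSpectralTail {d : ℕ} {Ω Ω' : Type*} [MeasurableSpace Ω] [MeasurableSpace Ω']
    (P : Measure Ω) (Z : Ω → Fld d) (Q : Measure Ω') (Θ : Ω' → Fld d) : Prop :=
  Measurable Θ ∧ ∀ A : Set (Fld d), MeasurableSet A →
    Q (Θ ⁻¹' A) =
      ∫⁻ ω, (Z ω 0 : ℝ≥0∞) *
        A.indicator (fun _ => (1 : ℝ≥0∞)) (fun t => Z ω t / Z ω 0) ∂P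

/-- Ratio of cardinalities of nested cubes tends to one. -/
lemma ratio_tendsto (d : ℕ) (c : ℤ) :
    Tendsto (fun n : ℕ => ((((n : ℤ) + c).toNat ^ d : ℕ) : ℝ≥0∞) / (n : ℝ≥0∞) ^ d)
      atTop (nhds 1) := by
  have h1 : Tendsto (fun n : ℕ => ENNReal.ofReal (1 + (c : ℝ) / (n : ℝ))) atTop (nhds 1) := by
    have h2 : Tendsto (fun n : ℕ => (1 + (c : ℝ) / (n : ℝ))) atTop (nhds (1 + 0)) :=
      tendsto_const_nhds.add (tendsto_const_div_atTop_nhds_zero_nat (c : ℝ))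
    have h3 := ENNReal.tendsto_ofReal h2
    simpa using h3
  have h4 : Tendsto (fun n : ℕ => (ENNReal.ofReal (1 + (c : ℝ) / (n : ℝ))) ^ d)
      atTop (nhds 1) := by
    have := ENNReal.Tendsto.pow (n := d) h1
    simpa using this
  refine h4.congr' ?_
  filter_upwards [eventually_ge_atTop (c.natAbs + 1)] with n hn
  have hn0 : (0 : ℝ) < n := by
    have : 0 < n := by omega
    exact_mod_cast this
  have hc : (0 : ℤ) ≤ (n : ℤ) + c := by omega
  have e : (1 + (c : ℝ) / (n : ℝ)) = (((n : ℤ) + c).toNat : ℝ) / (n : ℝ) := by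
    have : ((((n : ℤ) + c).toNat : ℤ) : ℝ) = (n : ℝ) + c := by
      rw [Int.toNat_of_nonneg hc]; push_cast; ring
    rw [Int.cast_natCast] at this
    rw [this]; field_simp
  rw [e, ENNReal.ofReal_div_of_pos hn0, ENNReal.ofReal_natCast, ENNReal.ofReal_natCast]
  rw [Nat.cast_pow, div_eq_mul_inv, div_eq_mul_inv, mul_pow, ENNReal.inv_pow]

/-- The cube as a finset. -/
noncomputable def cubeF (d n : ℕ) : Finset (Idx d) := Fintype.piFinset fun _ => Finset.Icc 0 (n : ℤ)

/-- The inner cube as a finset. -/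
noncomputable def innerF (d n K : ℕ) : Finset (Idx d) :=
  Fintype.piFinset fun _ => Finset.Icc (K : ℤ) ((n : ℤ) - K)

lemma mem_cubeF {d n : ℕ} {t : Idx d} : t ∈ cubeF d n ↔ t ∈ cube d n := by
  simp [cubeF, cube, Fintype.mem_piFinset]

lemma card_cubeF (d n : ℕ) : (cubeF d n).card = ((n : ℤ) + 1).toNat ^ d := by
  simp [cubeF, Fintype.card_piFinset]

lemma card_innerF (d n K : ℕ) :
    (innerF d n K).card = ((n : ℤ) + (1 - 2 * K)).toNat ^ d := by
  simp only [innerF, Fintype.card_piFinset, Int.card_Icc, Finset.prod_const, Finset.card_univ,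
    Fintype.card_fin]
  congr 2; ring

lemma cube_iSup {d n : ℕ} (a : Fld d) :
    (⨆ t ∈ cube d n, (a t : ℝ≥0∞)) = ⨆ t ∈ cubeF d n, (a t : ℝ≥0∞) := by
  simp only [mem_cubeF]

open Classical in
lemma pointwise_bound {d : ℕ} (a : Fld d) (C I : Finset (Idx d)) (i : Idx d) (hi : i ≠ 0)
    (hIC : I ⊆ C) (hI : ∀ t ∈ I, t + i ∈ C) :
    (⨆ t ∈ C, (a t : ℝ≥0∞)) +
      ∑ t ∈ I, (a t : ℝ≥0∞) * (if a t ≤ a (t + i) then 1 else 0) ≤ ∑ t ∈ C, (a t : ℝ≥0∞) := by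
  rcases C.eq_empty_or_nonempty with rfl | hC
  · have : I = ∅ := Finset.subset_empty.mp hIC
    subst this; simp
  obtain ⟨s, hs, hmax⟩ := Finset.exists_max_image C
    (fun t => toLex (a t, ∑ j, t j * i j)) hC
  have hsup : ∀ t ∈ C, a t ≤ a s := by
    intro t ht
    have := hmax t ht
    rw [Prod.Lex.toLex_le_toLex] at this
    rcases this with h | h
    · exact h.le
    · exact h.1.le
  have hpos : 0 < ∑ j, i j * i j := by
    obtain ⟨j, hj⟩ := Function.ne_iff.mp hi
    exact Finset.sum_pos' (fun j _ => mul_self_nonneg _)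
      ⟨j, Finset.mem_univ _, mul_self_pos.mpr hj⟩
  have hsB : s ∉ I.filter (fun t => a t ≤ a (t + i)) := by
    intro h
    rw [Finset.mem_filter] at h
    have := hmax _ (hI s h.1)
    rw [Prod.Lex.toLex_le_toLex] at this
    rcases this with h' | h'
    · exact absurd h.2 (not_le.mpr h')
    · have h2 := h'.2
      simp only [Pi.add_apply, add_mul, Finset.sum_add_distrib] at h2
      omega
  calc _ ≤ (a s : ℝ≥0∞) + ∑ t ∈ I.filter (fun t => a t ≤ a (t + i)), (a t : ℝ≥0∞) := by
        gcongr
        · exact iSup₂_le fun t ht => by exact_mod_cast hsup t ht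
        · rw [Finset.sum_filter]
          apply le_of_eq
          refine Finset.sum_congr rfl fun t _ => ?_
          split_ifs <;> simp
    _ = ∑ t ∈ insert s (I.filter (fun t => a t ≤ a (t + i))), (a t : ℝ≥0∞) := by
        rw [Finset.sum_insert hsB]
    _ ≤ _ := by
        apply Finset.sum_le_sum_of_subset
        intro t ht
        rcases Finset.mem_insert.mp ht with rfl | h
        · exact hs
        · exact hIC (Finset.mem_filter.mp h).1

section aux
variable {d : ℕ} {Ω : Type*} [MeasurableSpace Ω] {P : Measure Ω} {Z : Ω → Fld d}

lemma meas_coord (hZ : IsBRS P Z) (t : Idx d) : Measurable fun ω => Z ω t :=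
  (measurable_pi_apply t).comp hZ.meas

open Classical in
lemma meas_le (s t : Idx d) :
    Measurable (fun f : Fld d => if f s ≤ f t then (1 : ℝ≥0∞) else 0) :=
  Measurable.ite (measurableSet_le (measurable_pi_apply s) (measurable_pi_apply t))
    measurable_const measurable_const

open Classical in
lemma tilt_le (hZ : IsBRS P Z) (h t : Idx d) :
    ∫⁻ ω, (Z ω h : ℝ≥0∞) * (if Z ω h ≤ Z ω (h + t) then 1 else 0) ∂P =
    ∫⁻ ω, (Z ω 0 : ℝ≥0∞) * (if Z ω 0 ≤ Z ω t then 1 else 0) ∂P := by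
  have := hZ.tilt_shift h (fun f => if f h ≤ f (h + t) then 1 else 0) (meas_le _ _) (by
    intro c hc f
    simp only [mul_le_mul_iff_right₀ hc])
  simpa [shift] using this

open Classical in
lemma tilt_pos (hZ : IsBRS P Z) (h t : Idx d) :
    ∫⁻ ω, (Z ω h : ℝ≥0∞) * (if Z ω t = 0 then 0 else 1) ∂P =
    ∫⁻ ω, (Z ω 0 : ℝ≥0∞) * (if Z ω (t - h) = 0 then 0 else 1) ∂P := by
  have := hZ.tilt_shift h (fun f => if f t = 0 then 0 else 1)
    (Measurable.ite ((measurable_pi_apply t) (measurableSet_singleton 0))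
      measurable_const measurable_const) (by
    intro c hc f
    simp [hc.ne'])
  exact this

open Classical in
lemma H_add_le (hZ : IsBRS P Z) {H : ℝ≥0∞}
    (hH : Tendsto (fun n : ℕ => cubeMaxExp P Z n / (n : ℝ≥0∞) ^ d) atTop (nhds H))
    (i : Idx d) (hi : i ≠ 0) :
    H + ∫⁻ ω, (Z ω 0 : ℝ≥0∞) * (if Z ω 0 ≤ Z ω i then 1 else 0) ∂P ≤ 1 := by
  set r := ∫⁻ ω, (Z ω 0 : ℝ≥0∞) * (if Z ω 0 ≤ Z ω i then 1 else 0) ∂P with hr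
  have hm : ∀ t, Measurable fun ω =>
      (Z ω t : ℝ≥0∞) * (if Z ω t ≤ Z ω (t + i) then (1 : ℝ≥0∞) else 0) := fun t =>
    (meas_coord hZ t).coe_nnreal_ennreal.mul ((meas_le t (t + i)).comp hZ.meas)
  have hr1 : r ≤ 1 := by
    rw [← hZ.mean_one 0]
    refine lintegral_mono fun ω => ?_
    dsimp only
    split_ifs <;> simp
  obtain ⟨K, hK⟩ : ∃ K : ℕ, ∀ j, |i j| ≤ (K : ℤ) :=
    ⟨∑ j, (i j).natAbs, fun j => by
      rw [Int.abs_eq_natAbs]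
      exact_mod_cast Finset.single_le_sum (f := fun j => (i j).natAbs)
        (fun _ _ => Nat.zero_le _) (Finset.mem_univ j)⟩
  have hb : ∀ n : ℕ, cubeMaxExp P Z n / (n : ℝ≥0∞) ^ d +
      ((((n : ℤ) + (1 - 2 * K)).toNat ^ d : ℕ) : ℝ≥0∞) / (n : ℝ≥0∞) ^ d * r ≤
      ((((n : ℤ) + 1).toNat ^ d : ℕ) : ℝ≥0∞) / (n : ℝ≥0∞) ^ d := by
    intro n
    rw [← card_cubeF, ← card_innerF]
    rw [ENNReal.mul_comm_div, ← mul_div_assoc]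
    rw [← ENNReal.add_div]
    gcongr
    calc _ = ∫⁻ ω, ((⨆ t ∈ cubeF d n, (Z ω t : ℝ≥0∞)) + ∑ t ∈ innerF d n K,
            (Z ω t : ℝ≥0∞) * (if Z ω t ≤ Z ω (t + i) then 1 else 0)) ∂P := by
          rw [lintegral_add_right _ (Finset.measurable_sum _ fun t _ => hm t)]
          congr 1
          · simp only [cubeMaxExp, cube_iSup]
          · rw [lintegral_finsetSum _ fun t _ => hm t]
            rw [Finset.sum_congr rfl fun t _ => tilt_le hZ t i]
            rw [Finset.sum_const, nsmul_eq_mul, hr]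
      _ ≤ ∫⁻ ω, ∑ t ∈ cubeF d n, (Z ω t : ℝ≥0∞) ∂P := by
          refine lintegral_mono fun ω => pointwise_bound (Z ω) _ _ i hi ?_ ?_
          · intro t ht
            simp only [innerF, cubeF, Fintype.mem_piFinset, Finset.mem_Icc] at ht ⊢
            intro j; have := ht j; omega
          · intro t ht
            simp only [innerF, cubeF, Fintype.mem_piFinset, Finset.mem_Icc, Pi.add_apply] at ht ⊢
            intro j; have := ht j; have := abs_le.mp (hK j); omega
      _ = _ := by
          rw [lintegral_finsetSum _ fun t _ => (meas_coord hZ t).coe_nnreal_ennreal]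
          simp [hZ.mean_one]
  have hl := hH.add (ENNReal.Tendsto.mul_const (ratio_tendsto d (1 - 2 * K))
    (b := r) (Or.inl one_ne_zero))
  rw [one_mul] at hl
  exact le_of_tendsto_of_tendsto' hl (ratio_tendsto d 1) hb

open Classical in
lemma zero_of_H (hZ : IsBRS P Z) 
    (hH : Tendsto (fun n : ℕ => cubeMaxExp P Z n / (n : ℝ≥0∞) ^ d) atTop (nhds 1))
    (i : Idx d) (hi : i ≠ 0) : ∀ᵐ ω ∂P, Z ω 0 * Z ω i = 0 := by
  have key : ∀ i : Idx d, i ≠ 0 →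
      ∫⁻ ω, (Z ω 0 : ℝ≥0∞) * (if Z ω 0 ≤ Z ω i then 1 else 0) ∂P = 0 := by
    intro i hi
    have := H_add_le hZ hH i hi
    have h2 : (1 : ℝ≥0∞) + ∫⁻ ω, (Z ω 0 : ℝ≥0∞) * (if Z ω 0 ≤ Z ω i then 1 else 0) ∂P ≤ 1 + 0 := by
      simpa using this
    exact le_antisymm ((ENNReal.add_le_add_iff_left ENNReal.one_ne_top).mp h2) zero_le
  have hm : ∀ s t, Measurable fun ω =>
      (Z ω s : ℝ≥0∞) * (if Z ω s ≤ Z ω t then (1 : ℝ≥0∞) else 0) := fun s t =>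
    (meas_coord hZ s).coe_nnreal_ennreal.mul ((meas_le s t).comp hZ.meas)
  have h1 := key i hi
  have h2 := key (-i) (neg_ne_zero.mpr hi)
  rw [← tilt_le hZ i (-i), add_neg_cancel] at h2
  rw [lintegral_eq_zero_iff (hm _ _)] at h1 h2
  filter_upwards [h1, h2] with ω h1 h2
  rcases le_total (Z ω 0) (Z ω i) with h | h
  · simp [h] at h1; simp [h1]
  · simp [h] at h2; simp [h2]

open Classical in
lemma prod_zero_iff (hZ : IsBRS P Z) (s t : Idx d) :
    (∫⁻ ω, (Z ω s : ℝ≥0∞) * (if Z ω t = 0 then 0 else 1) ∂P = 0) ↔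
      ∀ᵐ ω ∂P, Z ω s * Z ω t = 0 := by
  rw [lintegral_eq_zero_iff]
  · refine eventually_congr (Eventually.of_forall fun ω => ?_)
    by_cases h : Z ω t = 0 <;> simp [h]
  · exact (meas_coord hZ s).coe_nnreal_ennreal.mul
      (Measurable.ite ((meas_coord hZ t) (measurableSet_singleton 0))
      measurable_const measurable_const)

lemma H_of_zero (hZ : IsBRS P Z) {H : ℝ≥0∞}
    (hH : Tendsto (fun n : ℕ => cubeMaxExp P Z n / (n : ℝ≥0∞) ^ d) atTop (nhds H))
    (h0 : ∀ i : Idx d, i ≠ 0 → ∀ᵐ ω ∂P, Z ω 0 * Z ω i = 0) : H = 1 := by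
  have hst : ∀ s t : Idx d, s ≠ t → ∀ᵐ ω ∂P, Z ω s * Z ω t = 0 := by
    intro s t hst
    rw [← prod_zero_iff hZ, tilt_pos hZ, prod_zero_iff hZ]
    exact h0 _ (sub_ne_zero.mpr hst.symm)
  have hall : ∀ᵐ ω ∂P, ∀ s t : Idx d, s ≠ t → Z ω s * Z ω t = 0 := by
    rw [ae_all_iff]; intro s
    rw [ae_all_iff]; intro t
    by_cases h : s = t
    · simp [h]
    · simpa [h] using hst s t h
  refine tendsto_nhds_unique hH ((ratio_tendsto d 1).congr fun n => ?_)
  congr 1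
  rw [← card_cubeF]
  calc _ = ∫⁻ ω, ∑ t ∈ cubeF d n, (Z ω t : ℝ≥0∞) ∂P := by
        rw [lintegral_finsetSum _ fun t _ => (meas_coord hZ t).coe_nnreal_ennreal]
        simp [hZ.mean_one]
    _ = _ := by
        refine lintegral_congr_ae ?_
        filter_upwards [hall] with ω hω
        rw [cube_iSup]
        apply le_antisymm
        · by_cases h : ∃ s ∈ cubeF d n, Z ω s ≠ 0
          · obtain ⟨s, hs, hs0⟩ := h
            rw [Finset.sum_eq_single_of_mem s hs]
            · exact le_iSup₂ (f := fun t (_ : t ∈ cubeF d n) => (Z ω t : ℝ≥0∞)) s hs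
            · intro t _ hts
              have := hω t s hts
              simpa [hs0] using this
          · push Not at h
            rw [Finset.sum_eq_zero]
            · exact zero_le
            · intro t ht; simp [h t ht]
        · exact iSup₂_le fun t ht => Finset.single_le_sum
            (f := fun t => (Z ω t : ℝ≥0∞)) (fun _ _ => zero_le) ht

lemma theta_iff {Ω' : Type*} [MeasurableSpace Ω'] {Q : Measure Ω'} {Θ : Ω' → Fld d}
    (hZ : IsBRS P Z) (hΘ : IsSpectralTail P Z Q Θ) (i : Idx d) :
    (∀ᵐ ω ∂Q, Θ ω i = 0) ↔ ∀ᵐ ω ∂P, Z ω 0 * Z ω i = 0 := by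
  classical
  have hA : MeasurableSet {f : Fld d | ¬ f i = 0} :=
    ((measurable_pi_apply i) (measurableSet_singleton 0)).compl
  have h := hΘ.2 _ hA
  rw [← prod_zero_iff hZ, ae_iff]
  have e : ∫⁻ ω, (Z ω 0 : ℝ≥0∞) * (if Z ω i = 0 then 0 else 1) ∂P = Q {a | ¬ Θ a i = 0} := by
    change _ = Q (Θ ⁻¹' {f : Fld d | ¬ f i = 0})
    rw [h]
    refine lintegral_congr fun ω => ?_
    by_cases h0 : Z ω 0 = 0
    · simp [h0]
    · by_cases h1 : Z ω i = 0 <;> simp [Set.indicator, h0, h1]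
  rw [e]

end aux

/-- For `Z` Brown–Resnick stationary with `E[Z(t)] = 1` and
`max_t Z(t) > 0` a.s., with spectral tail field `Θ`, the classical extremal index
equals `1` iff `P(Θ(i) = 0) = 1` for every `i ≠ 0`, equivalently iff
`Z(0)·Z(i) = 0` a.s. for every `i ≠ 0`. -/
theorem stmt9 {d : ℕ} (hd : 0 < d) {Ω Ω' : Type*} [MeasurableSpace Ω] [MeasurableSpace Ω']
    (P : Measure Ω) [IsProbabilityMeasure P] (Q : Measure Ω') [IsProbabilityMeasure Q]
    (Z : Ω → Fld d) (hZ : IsBRS P Z) (hZpos : ∀ᵐ ω ∂P, ∃ t, 0 < Z ω t)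
    (Θ : Ω' → Fld d) (hΘ : IsSpectralTail P Z Q Θ)
    (H : ℝ≥0∞)
    (hH : Tendsto (fun n : ℕ => cubeMaxExp P Z n / (n : ℝ≥0∞) ^ d) atTop (nhds H)) :
    (H = 1 ↔ ∀ i : Idx d, i ≠ 0 → (∀ᵐ ω ∂Q, Θ ω i = 0)) ∧
    (H = 1 ↔ ∀ i : Idx d, i ≠ 0 → (∀ᵐ ω ∂P, Z ω 0 * Z ω i = 0)) := by
  have h2 : H = 1 ↔ ∀ i : Idx d, i ≠ 0 → (∀ᵐ ω ∂P, Z ω 0 * Z ω i = 0) := by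
    constructor
    · intro h i hi
      subst h
      exact zero_of_H hZ hH i hi
    · exact H_of_zero hZ hH
  refine ⟨?_, h2⟩
  rw [h2]
  exact forall₂_congr fun i _ => (theta_iff hZ hΘ i).symm
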